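/- arXiv:2408.15456 — 4 statements merged into one kernel-verified Lean document; each statement's English description precedes it below -/
import Mathlib

section
/- Let n be a positive integer and let F, X, L, M, N be real n×n matrices satisfying the two Lyapunov-type equations X·F + Fᵀ·X + M = 0 and F·L + L·Fᵀ + N = 0. Then trace(X·N) = trace(M·L). -/
open Matrix

/-- **Trace duality for Lyapunov equations.**
If `X·F + Fᵀ·X + M = 0` and `F·L + L·Fᵀ + N = 0`, then `trace(X·N) = trace(M·L)`. -/
theorem trace_duality_lyapunov {n : ℕ} (hn : 0 < n)
    (F X L M N : Matrix (Fin n) (Fin n) ℝ)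
    (h₁ : X * F + Fᵀ * X + M = 0)
    (h₂ : F * L + L * Fᵀ + N = 0) :
    (X * N).trace = (M * L).trace := by
  rw [eq_neg_of_add_eq_zero_right h₁, eq_neg_of_add_eq_zero_right h₂]
  simp only [mul_neg, neg_mul, trace_neg, mul_add, add_mul, trace_add, ← mul_assoc]
  rw [trace_mul_cycle X L Fᵀ]
end

section
/- Fix an integer N ≥ 2, dimensions n, m, κ₁, …, κ_{N-1}, and matrices B ∈ ℝ^{n×m}, C ∈ ℝ^{n×n}, R ∈ ℝ^{m×m}. Let K₁ : ℝ → ℝ^{κ₁×n}, K_i : ℝ → ℝ^{κ_i×κ_{i-1}} (for 2 ≤ i ≤ N-1), K_N : ℝ → ℝ^{m×κ_{N-1}} be differentiable paths, and let P, L : ℝ → ℝ^{n×n} be arbitrary matrix-valued functions. Define B_i(t) := B·K_N(t)⋯K_{i+1}(t) for i < N and B_N := B; C_i(t) := K_{i-1}(t)⋯K₁(t)·C for i > 1 and C₁ := C; R_i(t) := K_{i+1}(t)ᵀ⋯K_N(t)ᵀ·R·K_N(t)⋯K_{i+1}(t) for i < N and R_N := R. Suppose that for every i ∈ {1,…,N}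 and every t, the derivative satisfies K_i'(t) = -2(B_i(t)ᵀP(t) + R_i(t)K_i(t)C_i(t))·L(t)·C_i(t)ᵀ. Then for every i ∈ {1,…,N-1}, the quantity K_i(t)K_i(t)ᵀ - K_{i+1}(t)ᵀK_{i+1}(t) is constant in t, i.e., equal to its value at t = 0. -/
open Matrix

/-- The entrywise product rule for products of matrix-valued functions. -/
theorem hasDerivAt_matrix_mul_apply {l m n : Type*} [Fintype m]
    {X : ℝ → Matrix l m ℝ} {Y : ℝ → Matrix m n ℝ} {X' : Matrix l m ℝ} {Y' : Matrix m n ℝ} {t : ℝ}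
    (hX : ∀ a b, HasDerivAt (fun s => X s a b) (X' a b) t)
    (hY : ∀ a b, HasDerivAt (fun s => Y s a b) (Y' a b) t) (a : l) (b : n) :
    HasDerivAt (fun s => (X s * Y s) a b) ((X' * Y t + X t * Y') a b) t := by
  simp only [Matrix.add_apply, Matrix.mul_apply, ← Finset.sum_add_distrib]
  exact HasDerivAt.fun_sum fun c _ => (hX a c).mul (hY c b)

/-- If `X' * Xᵀ = Yᵀ * Y'` along matrix paths `X` and `Y`, then `X * Xᵀ - Yᵀ * Y` is constant. -/
theorem mul_transpose_sub_transpose_mul_eq {l m n : Type*} [Fintype l] [Fintype n]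
    {X X' : ℝ → Matrix m l ℝ} {Y Y' : ℝ → Matrix n m ℝ}
    (hX : ∀ t a b, HasDerivAt (fun s => X s a b) (X' t a b) t)
    (hY : ∀ t a b, HasDerivAt (fun s => Y s a b) (Y' t a b) t)
    (hXY : ∀ t, X' t * (X t)ᵀ = (Y t)ᵀ * Y' t) (t t₀ : ℝ) :
    X t * (X t)ᵀ - (Y t)ᵀ * Y t = X t₀ * (X t₀)ᵀ - (Y t₀)ᵀ * Y t₀ := by
  ext a b
  have hderiv : ∀ s, HasDerivAt (fun s => (X s * (X s)ᵀ - (Y s)ᵀ * Y s) a b) 0 s := by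
    intro s
    have h1 := hasDerivAt_matrix_mul_apply (Y := fun s => (X s)ᵀ) (Y' := (X' s)ᵀ)
      (hX s) (fun a b => hX s b a) a b
    have h2 := hasDerivAt_matrix_mul_apply (X := fun s => (Y s)ᵀ) (X' := (Y' s)ᵀ)
      (fun a b => hY s b a) (hY s) a b
    have hT : X s * (X' s)ᵀ = (Y' s)ᵀ * Y s := by
      simpa using congrArg Matrix.transpose (hXY s)
    refine (h1.sub h2).congr_deriv ?_
    rw [hXY s, hT, add_comm, sub_self]
  exact is_const_of_deriv_eq_zero (fun s => (hderiv s).differentiableAt)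
    (fun s => (hderiv s).deriv) t t₀

/-- **Conservation law for the overparameterized LQR gradient flow.**
Layer dimensions are `d 0, d 1, …, d N` (input dimension `n = d 0`, output dimension
`m = d N`).  The layers are indexed here 0-based: `K j : ℝ → Matrix (Fin (d (j+1))) (Fin (d j)) ℝ`
(for `0 ≤ j < N`) is the paper's layer `K_{j+1}`.  `Suf i = K_N ⋯ K_{i+1}` (paper indices) and
`Pre j = K_j ⋯ K_1` are the suffix and prefix products, so the paper's `B_i`, `C_i`, `R_i` for the
layer `K j = K_{j+1}` are `B * Suf (j+1)`, `Pre j * C` and `(Suf (j+1))ᵀ * R * Suf (j+1)`.  If each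
layer follows the gradient-flow dynamics `K_i' = -2(B_iᵀP + R_i K_i C_i) L C_iᵀ` (entrywise
derivatives, with `P, L` arbitrary matrix functions of time), then for every pair of consecutive
layers the quantity `K_i K_iᵀ - K_{i+1}ᵀ K_{i+1}` is constant in time. -/
theorem overparameterized_lqr_conservation_law
    (N : ℕ) (hN : 2 ≤ N) (d : ℕ → ℕ)
    (B : Matrix (Fin (d 0)) (Fin (d N)) ℝ)
    (C : Matrix (Fin (d 0)) (Fin (d 0)) ℝ)
    (R : Matrix (Fin (d N)) (Fin (d N)) ℝ)
    (K : (j : ℕ) → ℝ → Matrix (Fin (d (j + 1))) (Fin (d j)) ℝ)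
    (P L : ℝ → Matrix (Fin (d 0)) (Fin (d 0)) ℝ)
    -- suffix products `Suf i = K_N ⋯ K_{i+1}` (paper indices):
    (Suf : (i : ℕ) → ℝ → Matrix (Fin (d N)) (Fin (d i)) ℝ)
    (hSufN : ∀ t, Suf N t = 1)
    (hSuf : ∀ i, i < N → ∀ t, Suf i t = Suf (i + 1) t * K i t)
    -- prefix products `Pre j = K_j ⋯ K_1` (paper indices):
    (Pre : (j : ℕ) → ℝ → Matrix (Fin (d j)) (Fin (d 0)) ℝ)
    (hPre0 : ∀ t, Pre 0 t = 1)
    (hPre : ∀ j, j + 1 < N → ∀ t, Pre (j + 1) t = K j t * Pre j t)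
    -- gradient-flow dynamics `K_i' = -2 (B_iᵀ P + R_i K_i C_i) L C_iᵀ`, entrywise:
    (hflow : ∀ j, j < N → ∀ t : ℝ, ∀ (a : Fin (d (j + 1))) (b : Fin (d j)),
      HasDerivAt (fun s => K j s a b)
        ((-(2 : ℝ)) • (((B * Suf (j + 1) t)ᵀ * P t
            + ((Suf (j + 1) t)ᵀ * R * Suf (j + 1) t) * K j t * (Pre j t * C)) * L t
            * (Pre j t * C)ᵀ) a b) t) :
    ∀ j, j + 1 < N → ∀ t : ℝ,
      K j t * (K j t)ᵀ - (K (j + 1) t)ᵀ * K (j + 1) t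
        = K j 0 * (K j 0)ᵀ - (K (j + 1) 0)ᵀ * K (j + 1) 0 := by
  intro j hj t
  refine mul_transpose_sub_transpose_mul_eq
    (X' := fun t => (-(2 : ℝ)) • (((B * Suf (j + 1) t)ᵀ * P t
      + ((Suf (j + 1) t)ᵀ * R * Suf (j + 1) t) * K j t * (Pre j t * C)) * L t
      * (Pre j t * C)ᵀ))
    (Y' := fun t => (-(2 : ℝ)) • (((B * Suf (j + 1 + 1) t)ᵀ * P t
      + ((Suf (j + 1 + 1) t)ᵀ * R * Suf (j + 1 + 1) t) * K (j + 1) t * (Pre (j + 1) t * C)) * L t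
      * (Pre (j + 1) t * C)ᵀ))
    (hflow j (by omega)) (hflow (j + 1) hj) (fun s => ?_) t 0
  simp only [hSuf (j + 1) hj s, hPre j hj s, Matrix.transpose_mul, Matrix.smul_mul,
    Matrix.mul_smul, Matrix.mul_add, Matrix.add_mul, Matrix.mul_assoc]
end

section
/- Let 𝕏 ⊆ ℝⁿ be open and f : 𝕏 → ℝⁿ continuously differentiable. Let x̄ ∈ 𝕏 be a strict saddle equilibrium of ẋ = f(x), i.e., f(x̄) = 0 and the Jacobian matrix Df(x̄) has at least one eigenvalue with strictly positive real part and at least one eigenvalue with nonpositive real part. Then there exists an open neighborhood B ⊆ 𝕏 of x̄ such that the finite-time domain of attraction 𝒟_F(B) := {ξ ∈ 𝕏 : the maximal solution φ(·,ξ) of ẋ = f(x) with φ(0,ξ) = ξ is defined on all of [0,∞) and there exists τ ≥ 0 with φ(t,ξ) ∈ B for all t ≥ τ} has Lebesgue measure zero. -/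
open MeasureTheory Set
open scoped RealInnerProductSpace

open Polynomial in
/-- Uniqueness for the Sylvester equation `a * x = x * b` when `a` and `b` are annihilated by
coprime polynomials. -/
theorem eq_zero_of_mul_eq_mul_of_isCoprime {K A : Type*} [CommRing K] [Ring A] [Algebra K A]
    {p q : K[X]} (hpq : IsCoprime p q) {a b x : A} (h : a * x = x * b)
    (ha : aeval a p = 0) (hb : aeval b q = 0) : x = 0 := by
  have key : ∀ r : K[X], aeval a r * x = x * aeval b r := by
    intro r
    induction r using Polynomial.induction_on' with
    | add r s hr hs => simp [add_mul, mul_add, hr, hs]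
    | monomial k c =>
      have hk : a ^ k * x = x * b ^ k := (show SemiconjBy x b a from h.symm).pow_right k |>.eq.symm
      simp only [aeval_monomial]
      rw [mul_assoc, hk, ← mul_assoc, ← mul_assoc, Algebra.commutes]
  obtain ⟨u, w, huw⟩ := hpq
  have h1 : aeval a (u * p + w * q) * x = 0 := by
    rw [map_add, add_mul, key (w * q)]
    simp [ha, hb]
  simpa [huw] using h1

open Polynomial in
/-- Solvability of the Lyapunov equation of `J - γ` when no two eigenvalues of `J` sum to `2γ`. -/
theorem Matrix.exists_lyapunov_of_isCoprime {n : ℕ} (J : Matrix (Fin n) (Fin n) ℝ) (γ : ℝ)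
    (h : IsCoprime J.charpoly (J.charpoly.comp (C (2 * γ) - X))) :
    ∃ Y : Matrix (Fin n) (Fin n) ℝ, Y.transpose = Y ∧
      J.transpose * Y + Y * J = (2 * γ) • Y + 1 := by
  let L : Matrix (Fin n) (Fin n) ℝ →ₗ[ℝ] Matrix (Fin n) (Fin n) ℝ :=
    LinearMap.mulLeft ℝ J.transpose + LinearMap.mulRight ℝ J - (2 * γ) • LinearMap.id
  have hL : ∀ Z, L Z = J.transpose * Z + Z * J - (2 * γ) • Z := fun Z => rfl
  have hinj : Function.Injective L := by
    rw [injective_iff_map_eq_zero]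
    intro Z hZ
    rw [hL] at hZ
    refine eq_zero_of_mul_eq_mul_of_isCoprime (K := ℝ) h (a := J.transpose)
      (b := algebraMap ℝ _ (2 * γ) - J) ?_ ?_ ?_
    · rw [mul_sub, ← Algebra.commutes, ← Algebra.smul_def]
      rw [sub_eq_zero] at hZ
      rw [← hZ]; abel
    · rw [← Matrix.charpoly_transpose]
      exact Matrix.aeval_self_charpoly _
    · rw [aeval_comp]
      simp [Matrix.aeval_self_charpoly]
  obtain ⟨Z, hZ⟩ := (LinearMap.injective_iff_surjective.1 hinj) 1
  rw [hL, sub_eq_iff_eq_add] at hZ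
  have hZ' := congrArg Matrix.transpose hZ
  simp only [Matrix.transpose_add, Matrix.transpose_mul, Matrix.transpose_transpose,
    Matrix.transpose_one, Matrix.transpose_smul] at hZ'
  refine ⟨(1 / 2 : ℝ) • (Z + Z.transpose), ?_, ?_⟩
  · simp [Matrix.transpose_smul, add_comm]
  · have : J.transpose * (Z + Z.transpose) + (Z + Z.transpose) * J =
        (2 * γ) • (Z + Z.transpose) + (2 : ℝ) • 1 := by
      rw [mul_add, add_mul, smul_add, two_smul]
      calc _ = (J.transpose * Z + Z * J) + (J.transpose * Z.transpose + Z.transpose * J) := by abel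
        _ = _ := by rw [hZ, add_comm (J.transpose * Z.transpose), hZ']; abel
    rw [Matrix.mul_smul, Matrix.smul_mul, ← smul_add, this, smul_add, smul_comm (1 / 2 : ℝ),
      smul_smul (1 / 2 : ℝ) 2]
    norm_num

open Polynomial in
theorem Matrix.exists_isCoprime_charpoly_comp_sub {n : ℕ} (J : Matrix (Fin n) (Fin n) ℝ) {r : ℝ}
    (hr : 0 < r) :
    ∃ γ, 0 < γ ∧ γ < r ∧ IsCoprime J.charpoly (J.charpoly.comp (C (2 * γ) - X)) := by
  classical
  let R : Finset ℂ := (J.charpoly.map (algebraMap ℝ ℂ)).roots.toFinset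
  have hmem : ∀ z : ℂ, aeval z J.charpoly = 0 → z ∈ R := by
    intro z hz
    simp only [R, Multiset.mem_toFinset]
    rw [mem_roots (J.charpoly_monic.map _).ne_zero, IsRoot, eval_map_algebraMap, hz]
  let S : Finset ℝ := (R ×ˢ R).image fun z => (z.1 + z.2).re / 2
  obtain ⟨γ, hγ, hγS⟩ := ((Ioo_infinite hr).sdiff S.finite_toSet).nonempty
  refine ⟨γ, hγ.1, hγ.2, ?_⟩
  rw [isCoprime_iff_aeval_ne_zero_of_isAlgClosed ℝ ℂ]
  intro z
  by_contra! hz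
  apply hγS
  have h2 := hmem _ hz.1
  have h3 : aeval ((2 * γ : ℂ) - z) J.charpoly = 0 := by
    have := hz.2
    rw [aeval_comp] at this
    simpa using this
  simp only [S, Finset.coe_image, mem_image]
  exact ⟨(z, 2 * γ - z), by simp [h2, hmem _ h3], by simp⟩

theorem Matrix.exists_real_eigenpair {n : ℕ} (J : Matrix (Fin n) (Fin n) ℝ) {μ : ℂ}
    (hμ : (J.map (fun x : ℝ => (x : ℂ))).charpoly.IsRoot μ) :
    ∃ x y : Fin n → ℝ, (x ≠ 0 ∨ y ≠ 0) ∧ J.mulVec x = μ.re • x - μ.im • y ∧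
      J.mulVec y = μ.im • x + μ.re • y := by
  rw [Polynomial.IsRoot, Matrix.eval_charpoly, ← Matrix.exists_mulVec_eq_zero_iff] at hμ
  obtain ⟨v, hv, hv0⟩ := hμ
  rw [Matrix.sub_mulVec, sub_eq_zero] at hv0
  refine ⟨fun i => (v i).re, fun i => (v i).im, ?_, ?_, ?_⟩
  · by_contra! h
    exact hv (funext fun i => Complex.ext (congrFun h.1 i) (congrFun h.2 i))
  all_goals
    funext i
    have := congrFun hv0 i
    rw [Matrix.scalar_apply, Matrix.mulVec_diagonal] at this
    simp only [Matrix.mulVec, dotProduct, Matrix.map_apply] at this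
  · simpa [Matrix.mulVec, dotProduct] using (congrArg Complex.re this).symm
  · have h := (congrArg Complex.im this).symm
    simp [Matrix.mulVec, dotProduct] at h ⊢
    linarith

/-- A matrix with an eigenvalue in the open right half-plane admits a quadratic form, somewhere
positive, whose derivative along the linear flow is `2γ` times the form plus `‖z‖ ^ 2`. -/
theorem Matrix.exists_indefinite_lyapunov {n : ℕ} (J : Matrix (Fin n) (Fin n) ℝ)
    (h : ∃ μ : ℂ, (J.map (fun x : ℝ => (x : ℂ))).charpoly.IsRoot μ ∧ 0 < μ.re) :
    ∃ (S : EuclideanSpace ℝ (Fin n) →L[ℝ] EuclideanSpace ℝ (Fin n)) (γ : ℝ), 0 < γ ∧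
      (∀ x y, ⟪S x, y⟫ = ⟪x, S y⟫) ∧
      (∀ z, 2 * ⟪S z, Matrix.toEuclideanCLM (𝕜 := ℝ) J z⟫ = 2 * γ * ⟪S z, z⟫ + ‖z‖ ^ 2) ∧
      ∃ v, 0 < ⟪S v, v⟫ := by
  obtain ⟨μ, hμ, hre⟩ := h
  obtain ⟨γ, hγ, hγr, hcop⟩ := J.exists_isCoprime_charpoly_comp_sub hre
  obtain ⟨Y, hYs, hY⟩ := J.exists_lyapunov_of_isCoprime γ hcop
  obtain ⟨x, y, hxy, hx, hy⟩ := J.exists_real_eigenpair hμ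
  let Φ := Matrix.toEuclideanCLM (n := Fin n) (𝕜 := ℝ)
  have hadj : ∀ (M : Matrix (Fin n) (Fin n) ℝ) a b, ⟪Φ M a, b⟫ = ⟪a, Φ M.transpose b⟫ := by
    intro M a b
    have : Φ M.transpose = star (Φ M) := by
      rw [← map_star, Matrix.star_eq_conjTranspose, Matrix.conjTranspose_eq_transpose_of_trivial]
    rw [this, ContinuousLinearMap.star_eq_adjoint, ContinuousLinearMap.adjoint_inner_right]
  have hsym : ∀ a b, ⟪Φ Y a, b⟫ = ⟪a, Φ Y b⟫ := by
    intro a b; rw [hadj, hYs]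
  have hlyap : ∀ z, 2 * ⟪Φ Y z, Φ J z⟫ = 2 * γ * ⟪Φ Y z, z⟫ + ‖z‖ ^ 2 := by
    intro z
    have h1 : Φ J.transpose (Φ Y z) + Φ Y (Φ J z) = (2 * γ) • Φ Y z + z := by
      have := congrArg (fun M => Φ M z) hY
      simpa [map_add, map_mul, map_smul] using this
    have h2 := congrArg (fun w => ⟪w, z⟫) h1
    simp only [inner_add_left, inner_smul_left, hadj J.transpose, Matrix.transpose_transpose,
      real_inner_self_eq_norm_sq] at h2
    rw [hsym (Φ J z) z, real_inner_comm (Φ Y z)] at h2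
    simp only [conj_trivial] at h2
    linarith
  refine ⟨Φ Y, γ, hγ, hsym, hlyap, ?_⟩
  let a : EuclideanSpace ℝ (Fin n) := WithLp.toLp 2 x
  let b : EuclideanSpace ℝ (Fin n) := WithLp.toLp 2 y
  have ha : Φ J a = μ.re • a - μ.im • b := by
    simp only [Φ, a, b, Matrix.toEuclideanCLM_toLp, hx]; rfl
  have hb : Φ J b = μ.im • a + μ.re • b := by
    simp only [Φ, a, b, Matrix.toEuclideanCLM_toLp, hy]; rfl
  have hpos : 0 < ‖a‖ ^ 2 + ‖b‖ ^ 2 := by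
    rcases hxy with h | h
    · have : a ≠ 0 := by simpa [a] using h
      positivity
    · have : b ≠ 0 := by simpa [b] using h
      positivity
  have e1 := hlyap a
  have e2 := hlyap b
  rw [ha, inner_sub_right, inner_smul_right, inner_smul_right] at e1
  rw [hb, inner_add_right, inner_smul_right, inner_smul_right, hsym b a, real_inner_comm (Φ Y a)] at e2
  by_contra! hneg
  nlinarith [hneg a, hneg b]

theorem exp_mul_le_of_mul_le_derivWithin {q q' : ℝ → ℝ} {c T : ℝ} (hT : 0 ≤ T)
    (hq : ∀ t ∈ Icc 0 T, HasDerivWithinAt q (q' t) (Ici 0) t)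
    (h : ∀ t ∈ Icc 0 T, c * q t ≤ q' t) : Real.exp (c * T) * q 0 ≤ q T := by
  have hexp : ∀ t : ℝ, HasDerivAt (fun t => Real.exp (-c * t)) (Real.exp (-c * t) * -c) t := by
    intro t
    simpa using ((hasDerivAt_id t).const_mul (-c)).exp
  have hmono : MonotoneOn (fun t => Real.exp (-c * t) * q t) (Icc 0 T) := by
    have hd : ∀ t ∈ interior (Icc 0 T), HasDerivAt (fun t => Real.exp (-c * t) * q t)
        (Real.exp (-c * t) * -c * q t + Real.exp (-c * t) * q' t) t := by
      intro t ht
      rw [interior_Icc] at ht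
      exact (hexp t).mul ((hq t (Ioo_subset_Icc_self ht)).hasDerivAt (Ici_mem_nhds ht.1))
    refine monotoneOn_of_deriv_nonneg (convex_Icc 0 T) ?_ ?_ ?_
    · intro t ht
      exact ((hexp t).continuousAt.continuousWithinAt).mul
        ((hq t ht).continuousWithinAt.mono Icc_subset_Ici_self)
    · exact fun t ht => (hd t ht).differentiableAt.differentiableWithinAt
    · intro t ht
      rw [(hd t ht).deriv]
      have := mul_nonneg (Real.exp_pos (-c * t)).le (sub_nonneg.2 (h t (interior_subset ht)))
      linarith
  have h0 := hmono (left_mem_Icc.2 hT) (right_mem_Icc.2 hT) hT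
  simp only [mul_zero, Real.exp_zero, one_mul] at h0
  calc Real.exp (c * T) * q 0 ≤ Real.exp (c * T) * (Real.exp (-c * T) * q T) := by gcongr
    _ = q T := by rw [← mul_assoc, ← Real.exp_add]; simp

section

variable {E : Type*} [NormedAddCommGroup E]

theorem HasDerivWithinAt.comp_const_add_Ici [NormedSpace ℝ E] {φ : ℝ → E} {φ' : E} {a t : ℝ}
    (ha : 0 ≤ a) (h : HasDerivWithinAt φ φ' (Ici 0) (a + t)) :
    HasDerivWithinAt (fun s => φ (a + s)) φ' (Ici 0) t := by
  have h1 : HasDerivWithinAt (fun s : ℝ => a + s) 1 (Ici 0) t :=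
    ((hasDerivAt_id t).const_add a).hasDerivWithinAt
  simpa [Function.comp_def] using
    HasDerivWithinAt.scomp t h h1 fun s hs => add_nonneg ha (mem_Ici.1 hs)

theorem addHaar_eq_zero_of_dist_le [NormedSpace ℝ E] [FiniteDimensional ℝ E] [MeasurableSpace E]
    [BorelSpace E] (μ : Measure E) [μ.IsAddHaarMeasure] {s t : Set E} {e : E → E} {C : NNReal}
    (he : ∀ x ∈ s, ∀ y ∈ s, dist x y ≤ C * dist (e x) (e y)) (hst : MapsTo e s t)
    (ht : μ t = 0) : μ s = 0 := by
  have hinj : InjOn e s := by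
    intro x hx y hy hxy
    have := he x hx y hy
    rw [hxy, dist_self, mul_zero] at this
    exact dist_le_zero.1 this
  have hg : LipschitzOnWith C (Function.invFunOn e s) (e '' s) := by
    refine LipschitzOnWith.of_dist_le_mul ?_
    rintro _ ⟨x, hx, rfl⟩ _ ⟨y, hy, rfl⟩
    rw [hinj.leftInvOn_invFunOn hx, hinj.leftInvOn_invFunOn hy]
    exact he x hx y hy
  have himg : Function.invFunOn e s '' (e '' s) = s := hinj.invFunOn_image subset_rfl
  have hH : μH[Module.finrank ℝ E] (e '' s) = 0 :=
    (Measure.absolutelyContinuous_isAddHaarMeasure μH[Module.finrank ℝ E] μ)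
      (measure_mono_null hst.image_subset ht)
  have h2 := hg.hausdorffMeasure_image_le (d := Module.finrank ℝ E) (by positivity)
  rw [himg, hH, mul_zero] at h2
  exact (Measure.absolutelyContinuous_isAddHaarMeasure μ μH[Module.finrank ℝ E])
    (nonpos_iff_eq_zero.1 h2)

variable [InnerProductSpace ℝ E]

theorem dist_le_exp_mul_dist_of_trajectories {f : E → E} {U : Set E} {K : NNReal}
    (hf : LipschitzOnWith K f U) {T : ℝ} (hT : 0 ≤ T) {φ ψ : ℝ → E}
    (hφ : ∀ t ∈ Icc 0 T, φ t ∈ U ∧ HasDerivWithinAt φ (f (φ t)) (Ici 0) t)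
    (hψ : ∀ t ∈ Icc 0 T, ψ t ∈ U ∧ HasDerivWithinAt ψ (f (ψ t)) (Ici 0) t) :
    dist (φ 0) (ψ 0) ≤ Real.exp (K * T) * dist (φ T) (ψ T) := by
  have h := exp_mul_le_of_mul_le_derivWithin (c := -(2 * K)) hT
    (fun t ht => ((hφ t ht).2.sub (hψ t ht).2).norm_sq) (fun t ht => by
      simp only [Pi.sub_apply]
      have h1 := hf.dist_le_mul _ (hφ t ht).1 _ (hψ t ht).1
      rw [dist_eq_norm, dist_eq_norm] at h1
      have h2 := abs_le.1 (abs_real_inner_le_norm (φ t - ψ t) (f (φ t) - f (ψ t)))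
      have h3 := mul_le_mul_of_nonneg_left h1 (norm_nonneg (φ t - ψ t))
      nlinarith [h2.1])
  simp only [Pi.sub_apply, ← dist_eq_norm] at h
  have h2 : (dist (φ 0) (ψ 0)) ^ 2 ≤ (Real.exp (K * T) * dist (φ T) (ψ T)) ^ 2 := by
    calc (dist (φ 0) (ψ 0)) ^ 2
        = Real.exp (K * T) ^ 2 * (Real.exp (-(2 * K) * T) * dist (φ 0) (ψ 0) ^ 2) := by
          rw [← mul_assoc, ← Real.exp_nat_mul, ← Real.exp_add]
          simp only [Nat.cast_ofNat]
          ring_nf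
          simp
      _ ≤ Real.exp (K * T) ^ 2 * dist (φ T) (ψ T) ^ 2 := by gcongr
      _ = _ := by ring
  exact le_of_sq_le_sq h2 (by positivity)

variable [FiniteDimensional ℝ E] [MeasurableSpace E] [BorelSpace E]

/-- The flow of a Lipschitz vector field pulls null sets back to null sets. -/
theorem addHaar_backward_trajectories_eq_zero (μ : Measure E) [μ.IsAddHaarMeasure] {f : E → E}
    {U : Set E} {K : NNReal} (hf : LipschitzOnWith K f U) {T : ℝ} (hT : 0 ≤ T) {Z : Set E}
    (hZ : μ Z = 0) :
    μ {x | ∃ φ : ℝ → E, φ 0 = x ∧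
      (∀ t ∈ Icc 0 T, φ t ∈ U ∧ HasDerivWithinAt φ (f (φ t)) (Ici 0) t) ∧ φ T ∈ Z} = 0 := by
  set A := {x | ∃ φ : ℝ → E, φ 0 = x ∧
      (∀ t ∈ Icc 0 T, φ t ∈ U ∧ HasDerivWithinAt φ (f (φ t)) (Ici 0) t) ∧ φ T ∈ Z} with hA
  have hch : ∀ x, ∃ φ : ℝ → E, x ∈ A → φ 0 = x ∧
      (∀ t ∈ Icc 0 T, φ t ∈ U ∧ HasDerivWithinAt φ (f (φ t)) (Ici 0) t) ∧ φ T ∈ Z := by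
    intro x
    by_cases hx : x ∈ A
    · obtain ⟨φ, hφ⟩ := hx
      exact ⟨φ, fun _ => hφ⟩
    · exact ⟨0, fun h => absurd h hx⟩
  choose Φ hΦ using hch
  refine addHaar_eq_zero_of_dist_le μ (e := fun x => Φ x T)
    (C := ⟨Real.exp (K * T), (Real.exp_pos _).le⟩) ?_ (fun x hx => (hΦ x hx).2.2) hZ
  intro x hx y hy
  have := dist_le_exp_mul_dist_of_trajectories hf hT (hΦ x hx).2.1 (hΦ y hy).2.1
  rwa [(hΦ x hx).1, (hΦ y hy).1] at this

theorem addHaar_eq_zero_of_quadratic_nonpos (μ : Measure E) [μ.IsAddHaarMeasure]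
    (S : E →L[ℝ] E) {v : E} (hv : 0 < ⟪S v, v⟫) {W : Set E}
    (hW : ∀ x ∈ W, ∀ y ∈ W, ⟪S (x - y), x - y⟫ ≤ 0) : μ W = 0 := by
  have hcl : ∀ x ∈ closure W, ∀ y ∈ closure W, ⟪S (x - y), x - y⟫ ≤ 0 := by
    intro x hx y hy
    have hclosed : IsClosed {p : E × E | ⟪S (p.1 - p.2), p.1 - p.2⟫ ≤ 0} :=
      isClosed_le (by fun_prop) continuous_const
    have hsub : closure (W ×ˢ W) ⊆ {p : E × E | ⟪S (p.1 - p.2), p.1 - p.2⟫ ≤ 0} :=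
      hclosed.closure_subset_iff.2 fun p hp => hW _ hp.1 _ hp.2
    exact hsub (a := (x, y)) (by rw [closure_prod_eq]; exact ⟨hx, hy⟩)
  refine measure_mono_null subset_closure ?_
  have hlim : Filter.Tendsto (fun n : ℕ => ((1 / 2 : ℝ) ^ n) • v) Filter.atTop
      (nhds ((0 : ℝ) • v)) :=
    (tendsto_pow_atTop_nhds_zero_of_lt_one (by norm_num) (by norm_num)).smul_const v
  refine Measure.addHaar_eq_zero_of_disjoint_translates μ
    (fun n : ℕ => ((1 / 2 : ℝ) ^ n) • v) (Metric.isBounded_range_of_tendsto _ hlim) ?_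
    isClosed_closure.measurableSet
  intro m n hmn
  rw [Function.onFun, Set.disjoint_left]
  simp only [singleton_add]
  rintro _ ⟨x, hx, rfl⟩ ⟨y, hy, hxy⟩
  have hne : (1 / 2 : ℝ) ^ m - (1 / 2) ^ n ≠ 0 := by
    rw [sub_ne_zero]
    exact (pow_right_strictAnti₀ (by norm_num) (by norm_num)).injective.ne hmn
  have hd : y - x = ((1 / 2 : ℝ) ^ m - (1 / 2) ^ n) • v := by
    rw [sub_smul, sub_eq_sub_iff_add_eq_add, add_comm y]
    exact hxy
  have h1 := hcl y hy x hx
  rw [hd, map_smul, inner_smul_left, inner_smul_right, conj_trivial, ← mul_assoc] at h1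
  exact absurd h1 (not_le.2 (mul_pos (mul_self_pos.2 hne) hv))

/-- If an indefinite quadratic form of differences grows exponentially along trajectories, then the
points whose forward trajectory stays in a bounded set form a null set. -/
theorem addHaar_forward_trapped_eq_zero (μ : Measure E) [μ.IsAddHaarMeasure] {f : E → E}
    {B : Set E} (hB : Bornology.IsBounded B) (S : E →L[ℝ] E) {γ : ℝ} (hγ : 0 < γ)
    (hS : ∀ x y, ⟪S x, y⟫ = ⟪x, S y⟫) {v : E} (hv : 0 < ⟪S v, v⟫)
    (hf : ∀ x ∈ B, ∀ y ∈ B, γ * ⟪S (x - y), x - y⟫ ≤ ⟪S (x - y), f x - f y⟫) :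
    μ {x | ∃ φ : ℝ → E, φ 0 = x ∧
      ∀ t ∈ Ici (0 : ℝ), φ t ∈ B ∧ HasDerivWithinAt φ (f (φ t)) (Ici 0) t} = 0 := by
  refine addHaar_eq_zero_of_quadratic_nonpos μ S hv ?_
  rintro x ⟨φ, rfl, hφ⟩ y ⟨ψ, rfl, hψ⟩
  obtain ⟨D, hD⟩ := Metric.isBounded_iff.1 hB
  have hgrow : ∀ T, 0 ≤ T → Real.exp (2 * γ * T) * ⟪S (φ 0 - ψ 0), φ 0 - ψ 0⟫ ≤
      ⟪S (φ T - ψ T), φ T - ψ T⟫ := by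
    intro T hT
    have hz : ∀ t ∈ Icc 0 T, HasDerivWithinAt (fun t => φ t - ψ t) (f (φ t) - f (ψ t)) (Ici 0) t :=
      fun t ht => (hφ t ht.1).2.sub (hψ t ht.1).2
    refine exp_mul_le_of_mul_le_derivWithin (c := 2 * γ)
      (q := fun t => ⟪S (φ t - ψ t), φ t - ψ t⟫) hT
      (fun t ht => (S.hasFDerivAt.comp_hasDerivWithinAt t (hz t ht)).inner ℝ (hz t ht)) ?_
    intro t ht
    have h1 := hf _ (hφ t ht.1).1 _ (hψ t ht.1).1
    have h2 : ⟪S (f (φ t) - f (ψ t)), φ t - ψ t⟫ = ⟪S (φ t - ψ t), f (φ t) - f (ψ t)⟫ := by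
      rw [hS, real_inner_comm]
    simp only [Function.comp_apply, h2]
    linarith
  have hbd : ∀ T, 0 ≤ T → ⟪S (φ T - ψ T), φ T - ψ T⟫ ≤ ‖S‖ * D * D := by
    intro T hT
    have h1 := hD (hφ T hT).1 (hψ T hT).1
    rw [dist_eq_norm] at h1
    have h0 : 0 ≤ D := (norm_nonneg _).trans h1
    calc ⟪S (φ T - ψ T), φ T - ψ T⟫ ≤ ‖S (φ T - ψ T)‖ * ‖φ T - ψ T‖ := real_inner_le_norm _ _
      _ ≤ (‖S‖ * ‖φ T - ψ T‖) * ‖φ T - ψ T‖ := by gcongr; exact S.le_opNorm _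
      _ ≤ ‖S‖ * D * D := by gcongr
  by_contra! hpos
  set q := ⟪S (φ 0 - ψ 0), φ 0 - ψ 0⟫ with hq
  have hM : 0 ≤ ‖S‖ * D * D := hpos.le.trans (hbd 0 le_rfl)
  set M := ‖S‖ * D * D
  have hT : 0 ≤ M / (2 * γ * q) := by positivity
  have h1 := (hgrow _ hT).trans (hbd _ hT)
  have h2 := mul_le_mul_of_nonneg_right (Real.add_one_le_exp (2 * γ * (M / (2 * γ * q)))) hpos.le
  have h3 : (2 * γ * (M / (2 * γ * q)) + 1) * q = M + q := by field_simp
  linarith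

/-- For a locally Lipschitz vector field, the points whose trajectory is eventually in a null set
form a null set. -/
theorem addHaar_eventually_trajectories_eq_zero (μ : Measure E) [μ.IsAddHaarMeasure] {f : E → E}
    {U : Set E}
    (hf : ∀ x ∈ U, ∃ K : NNReal, ∃ V : Set E, IsOpen V ∧ x ∈ V ∧ LipschitzOnWith K f V)
    {Z : Set E} (hZ : μ Z = 0) :
    μ {x | ∃ φ : ℝ → E, φ 0 = x ∧
      (∀ t ∈ Ici (0 : ℝ), φ t ∈ U ∧ HasDerivWithinAt φ (f (φ t)) (Ici 0) t) ∧
      ∃ τ : ℝ, ∀ t ≥ τ, φ t ∈ Z} = 0 := by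
  have hf' : ∀ x, ∃ K : NNReal, ∃ V : Set E, x ∈ U → IsOpen V ∧ x ∈ V ∧ LipschitzOnWith K f V := by
    intro x
    by_cases hx : x ∈ U
    · obtain ⟨K, V, h⟩ := hf x hx
      exact ⟨K, V, fun _ => h⟩
    · exact ⟨0, ∅, fun h => absurd h hx⟩
  choose K V hKV using hf'
  obtain ⟨C, hCU, hC, hcov⟩ := TopologicalSpace.countable_cover_nhdsWithin (f := V) (s := U)
    fun x hx => mem_nhdsWithin_of_mem_nhds ((hKV x hx).1.mem_nhds (hKV x hx).2.1)
  let pre : ℝ → Set E → Set E := fun h Y => ⋃ i ∈ C, {x | ∃ φ : ℝ → E, φ 0 = x ∧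
      (∀ t ∈ Icc 0 h, φ t ∈ V i ∧ HasDerivWithinAt φ (f (φ t)) (Ici 0) t) ∧ φ h ∈ Y}
  have hpre : ∀ h, 0 ≤ h → ∀ Y, μ Y = 0 → μ (pre h Y) = 0 := fun h hh Y hY =>
    (measure_biUnion_null_iff hC).2 fun i hi =>
      addHaar_backward_trajectories_eq_zero μ (hKV i (hCU hi)).2.2 hh hY
  have hiter : ∀ h, 0 ≤ h → ∀ k : ℕ, μ ((pre h)^[k] Z) = 0 := by
    intro h hh k
    induction k with
    | zero => exact hZ
    | succ k ih => rw [Function.iterate_succ_apply']; exact hpre h hh _ ih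
  refine measure_mono_null (t := ⋃ N : ℕ, ⋃ k : ℕ, (pre (1 / (N + 1 : ℝ)))^[k] Z) ?_
    (measure_iUnion_null fun N => measure_iUnion_null fun k => hiter _ (by positivity) k)
  rintro x ⟨φ, rfl, hφ, τ, hτ⟩
  have hcont : ContinuousOn φ (Ici 0) := fun t ht => (hφ t ht).2.continuousWithinAt
  have hcont' : Continuous fun t => φ (max t 0) :=
    hcont.comp_continuous (by fun_prop) fun t => mem_Ici.2 (le_max_right t 0)
  obtain ⟨δ, hδ, hleb⟩ := lebesgue_number_lemma_of_metric (s := Icc 0 (τ + 1)) (ι := C)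
    (c := fun i => (fun t => φ (max t 0)) ⁻¹' V i) isCompact_Icc
    (fun i => (hKV i (hCU i.2)).1.preimage hcont') (by
      intro t ht
      obtain ⟨i, hi, hti⟩ := mem_iUnion₂.1 (hcov (hφ t ht.1).1)
      refine mem_iUnion.2 ⟨⟨i, hi⟩, ?_⟩
      simpa [max_eq_left ht.1] using hti)
  obtain ⟨N, hN⟩ := exists_nat_one_div_lt hδ
  set h : ℝ := 1 / (N + 1 : ℝ) with hh
  have h0 : 0 < h := by positivity
  have h1 : h ≤ 1 := by
    rw [hh, div_le_one (by positivity)]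
    linarith [N.cast_nonneg (α := ℝ)]
  let k := ⌈τ / h⌉₊
  have hk : τ ≤ k * h := by
    have := Nat.le_ceil (τ / h)
    rwa [div_le_iff₀ h0] at this
  have hk' : ∀ j : ℕ, j < k → (j : ℝ) * h ≤ τ := by
    intro j hj
    have := Nat.lt_ceil.1 hj
    rw [lt_div_iff₀ h0] at this
    exact this.le
  have hback : ∀ j ≤ k, φ ((k - j : ℕ) * h) ∈ (pre h)^[j] Z := by
    intro j
    induction j with
    | zero => intro _; exact hτ _ hk
    | succ j ih =>
      intro hj
      rw [Function.iterate_succ_apply']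
      set m := k - (j + 1) with hm
      have hmk : k - j = m + 1 := by omega
      have hmτ := hk' m (by omega)
      have hm0 : 0 ≤ (m : ℝ) * h := by positivity
      have ih' := ih (by omega)
      rw [hmk] at ih'
      obtain ⟨i, hi⟩ := hleb (m * h) ⟨hm0, by linarith⟩
      refine mem_iUnion₂.2 ⟨i, i.2, fun s => φ (m * h + s), by simp, ?_, ?_⟩
      · intro t ht
        have hnn : 0 ≤ m * h + t := add_nonneg hm0 ht.1
        refine ⟨?_, (hφ _ hnn).2.comp_const_add_Ici hm0⟩
        have : m * h + t ∈ Metric.ball (m * h) δ := by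
          rw [Metric.mem_ball, Real.dist_eq, add_sub_cancel_left, abs_of_nonneg ht.1]
          exact ht.2.trans_lt hN
        simpa [max_eq_left hnn] using hi this
      · convert ih' using 2
        push_cast; ring
  refine mem_iUnion₂.2 ⟨N, k, ?_⟩
  have h_last := hback k le_rfl
  rwa [Nat.sub_self, Nat.cast_zero, zero_mul] at h_last

end

/-- **Basins of strict saddles have measure zero (local version).**
Let `f` be `C¹` on an open set `𝕏 ⊆ ℝⁿ` and let `xbar` be a strict saddle equilibrium of
`ẋ = f(x)`: `f(xbar) = 0` and the Jacobian `J` of `f` at `xbar` has a complex eigenvalue with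
strictly positive real part and one with nonpositive real part.  Then there is an open
neighborhood `B ⊆ 𝕏` of `xbar` whose finite-time domain of attraction (initial points whose
forward solution exists for all `t ≥ 0` and eventually remains in `B`) has Lebesgue measure
zero. -/
theorem strict_saddle_basin_measure_zero {n : ℕ}
    (𝕏 : Set (EuclideanSpace ℝ (Fin n))) (hX : IsOpen 𝕏)
    (f : EuclideanSpace ℝ (Fin n) → EuclideanSpace ℝ (Fin n))
    (hf : ContDiffOn ℝ 1 f 𝕏)
    (xbar : EuclideanSpace ℝ (Fin n)) (hxbar : xbar ∈ 𝕏) (hfxbar : f xbar = 0)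
    (J : Matrix (Fin n) (Fin n) ℝ)
    (hJ : HasFDerivAt f (Matrix.toEuclideanCLM (𝕜 := ℝ) J) xbar)
    (hsaddle₁ : ∃ μ : ℂ, (J.map (fun x : ℝ => (x : ℂ))).charpoly.IsRoot μ ∧ 0 < μ.re)
    (hsaddle₂ : ∃ μ : ℂ, (J.map (fun x : ℝ => (x : ℂ))).charpoly.IsRoot μ ∧ μ.re ≤ 0) :
    ∃ B : Set (EuclideanSpace ℝ (Fin n)), IsOpen B ∧ B ⊆ 𝕏 ∧ xbar ∈ B ∧
      volume {ξ : EuclideanSpace ℝ (Fin n) | ξ ∈ 𝕏 ∧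
        ∃ φ : ℝ → EuclideanSpace ℝ (Fin n), φ 0 = ξ ∧
          (∀ t ∈ Ici (0 : ℝ), φ t ∈ 𝕏 ∧ HasDerivWithinAt φ (f (φ t)) (Ici 0) t) ∧
          ∃ τ : ℝ, 0 ≤ τ ∧ ∀ t ≥ τ, φ t ∈ B} = 0 := by
  obtain ⟨S, γ, hγ, hS, hlyap, v, hv⟩ := J.exists_indefinite_lyapunov hsaddle₁
  have hstrict : ∀ x ∈ 𝕏, ContDiffAt ℝ 1 f x := fun x hx => hf.contDiffAt (hX.mem_nhds hx)
  have hsJ : HasStrictFDerivAt f (Matrix.toEuclideanCLM (𝕜 := ℝ) J) xbar :=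
    (hstrict xbar hxbar).hasStrictFDerivAt' hJ one_ne_zero
  have hε : 0 < 1 / (2 * (‖S‖ + 1)) := by positivity
  have hev := hsJ.isLittleO.def hε
  rw [nhds_prod_eq, Filter.eventually_prod_self_iff'] at hev
  obtain ⟨t, ht, hapx⟩ := hev
  obtain ⟨r, hr, hball⟩ := Metric.mem_nhds_iff.1 (Filter.inter_mem ht (hX.mem_nhds hxbar))
  have hcone : ∀ x ∈ Metric.ball xbar r, ∀ y ∈ Metric.ball xbar r,
      γ * ⟪S (x - y), x - y⟫ ≤ ⟪S (x - y), f x - f y⟫ := by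
    intro x hx y hy
    have h1 := hapx x (hball hx).1 y (hball hy).1
    set z := x - y
    set w := f x - f y - Matrix.toEuclideanCLM (𝕜 := ℝ) J z with hw
    have h2 : f x - f y = Matrix.toEuclideanCLM (𝕜 := ℝ) J z + w := by rw [hw]; abel
    have h3 := hlyap z
    have h4 : |⟪S z, w⟫| ≤ 1 / 2 * ‖z‖ ^ 2 := by
      calc |⟪S z, w⟫| ≤ ‖S z‖ * ‖w‖ := abs_real_inner_le_norm _ _
        _ ≤ ((‖S‖ + 1) * ‖z‖) * (1 / (2 * (‖S‖ + 1)) * ‖z‖) := by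
          gcongr
          exact (S.le_opNorm z).trans (by gcongr; linarith)
        _ = 1 / 2 * ‖z‖ ^ 2 := by field_simp
    rw [h2, inner_add_right]
    linarith [(abs_le.1 h4).1]
  refine ⟨Metric.ball xbar r, Metric.isOpen_ball, fun x hx => (hball hx).2,
    Metric.mem_ball_self hr, ?_⟩
  have hnull := addHaar_forward_trapped_eq_zero volume Metric.isBounded_ball S hγ hS hv hcone
  refine measure_mono_null ?_ (addHaar_eventually_trajectories_eq_zero volume (U := 𝕏) (f := f) ?_ hnull)
  · rintro ξ ⟨-, φ, h0, hφ, τ, hτ, hB⟩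
    refine ⟨φ, h0, hφ, τ, fun s hs => ⟨fun u => φ (s + u), by simp, fun u hu => ⟨?_, ?_⟩⟩⟩
    · exact hB _ (by linarith [mem_Ici.1 hu])
    · have hs0 : 0 ≤ s := hτ.trans hs
      exact (hφ _ (add_nonneg hs0 (mem_Ici.1 hu))).2.comp_const_add_Ici hs0
  · intro x hx
    obtain ⟨K, s, hs, hK⟩ := (hstrict x hx).exists_lipschitzOnWith
    obtain ⟨V, hV, hVo, hxV⟩ := mem_nhds_iff.1 hs
    exact ⟨K, V, hVo, hxV, hK.mono hV⟩
end

section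
/- Let 𝕏 ⊆ ℝⁿ be open and f : 𝕏 → ℝⁿ continuously differentiable. Let E ⊆ 𝕏 be a set consisting entirely of strict saddle equilibria of ẋ = f(x), i.e., every x̄ ∈ E satisfies f(x̄) = 0 and the Jacobian Df(x̄) has at least one eigenvalue with strictly positive real part and at least one eigenvalue with nonpositive real part. Then the set 𝒞_E := {ξ ∈ 𝕏 : the maximal solution φ(·,ξ) of ẋ = f(x) with φ(0,ξ) = ξ is defined on [0,∞) and converges as t → ∞ to some point of E} has Lebesgue measure zero. -/
open MeasureTheory Set Filter

open scoped NNReal RealInnerProductSpace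

/-- A linear map with a spectral plane on which its real part is positive admits a shifted
Lyapunov form which is positive somewhere. -/
lemma exists_shifted_lyapunov_form {F : Type*} [NormedAddCommGroup F] [InnerProductSpace ℝ F]
    [FiniteDimensional ℝ F] (A : F →L[ℝ] F) {α β : ℝ} (hα : 0 < α) {a b : F}
    (hab : a ≠ 0 ∨ b ≠ 0) (ha : A a = α • a - β • b) (hb : A b = β • a + α • b) :
    ∃ (c : ℝ) (X : F →L[ℝ] F) (v : F), 0 < c ∧
      (∀ z, ⟪z, X (A z)⟫ + ⟪A z, X z⟫ = c * ⟪z, X z⟫ + ‖z‖ ^ 2) ∧ 0 < ⟪v, X v⟫ := by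
  let L : Module.End ℝ (F →L[ℝ] F) :=
    LinearMap.mulRight ℝ A + LinearMap.mulLeft ℝ (ContinuousLinearMap.adjoint A)
  obtain ⟨c, ⟨hc0, hcα⟩, hc⟩ :=
    ((Ioo_infinite (by positivity : (0 : ℝ) < 2 * α)).sdiff L.finite_hasEigenvalue).nonempty
  have hunit : IsUnit (algebraMap ℝ (Module.End ℝ (F →L[ℝ] F)) c - L) := by
    by_contra h
    exact hc (Module.End.hasEigenvalue_iff_mem_spectrum.2 h)
  obtain ⟨X, hX⟩ := ((Module.End.isUnit_iff _).1 hunit).2 (-1)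
  have hX' : ∀ z, ⟪z, X (A z)⟫ + ⟪A z, X z⟫ = c * ⟪z, X z⟫ + ‖z‖ ^ 2 := by
    intro z
    have h1 : c • X z - (X (A z) + ContinuousLinearMap.adjoint A (X z)) = -z := by
      simpa [L] using congrArg (fun Y : F →L[ℝ] F ↦ Y z) hX
    have h2 := congrArg (fun y ↦ ⟪z, y⟫) h1
    simp only [inner_sub_right, inner_add_right, inner_smul_right, inner_neg_right,
      ContinuousLinearMap.adjoint_inner_right, real_inner_self_eq_norm_sq] at h2
    linarith
  have hsum : 0 < ⟪a, X a⟫ + ⟪b, X b⟫ := by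
    have h1 := hX' a
    have h2 := hX' b
    simp only [ha, hb, map_add, map_sub, map_smul, inner_add_left, inner_add_right,
      inner_sub_left, inner_sub_right, real_inner_smul_left, inner_smul_right] at h1 h2
    have h3 : 0 < ‖a‖ ^ 2 + ‖b‖ ^ 2 := by
      rcases hab with h | h
      · have := norm_pos_iff.2 h
        positivity
      · have := norm_pos_iff.2 h
        positivity
    have h4 : (2 * α - c) * (⟪a, X a⟫ + ⟪b, X b⟫) = ‖a‖ ^ 2 + ‖b‖ ^ 2 := by linarith
    exact pos_of_mul_pos_right (h4 ▸ h3) (by linarith)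
  by_cases h : 0 < ⟪a, X a⟫
  · exact ⟨c, X, a, hc0, hX', h⟩
  · exact ⟨c, X, b, hc0, hX', by linarith⟩

/-- A differential inequality `c * h ≤ h'` forces at least exponential growth. -/
lemma exp_mul_le_of_mul_le_deriv {h h' : ℝ → ℝ} {c T : ℝ} (hT : 0 ≤ T)
    (hd : ∀ t ∈ Icc 0 T, HasDerivWithinAt h (h' t) (Icc 0 T) t)
    (hle : ∀ t ∈ Icc 0 T, c * h t ≤ h' t) : Real.exp (c * T) * h 0 ≤ h T := by
  have hexp : ∀ t, HasDerivAt (fun s ↦ Real.exp (-c * s)) (Real.exp (-c * t) * -c) t := fun t ↦ by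
    simpa using ((hasDerivAt_id t).const_mul (-c)).exp
  have hderiv : ∀ t ∈ Icc 0 T, HasDerivWithinAt (fun s ↦ Real.exp (-c * s) * h s)
      (Real.exp (-c * t) * -c * h t + Real.exp (-c * t) * h' t) (Icc 0 T) t :=
    fun t ht ↦ (hexp t).hasDerivWithinAt.mul (hd t ht)
  have hmono : MonotoneOn (fun s ↦ Real.exp (-c * s) * h s) (Icc 0 T) := by
    refine monotoneOn_of_hasDerivWithinAt_nonneg (convex_Icc 0 T)
      (fun t ht ↦ (hderiv t ht).continuousWithinAt)
      (fun t ht ↦ (hderiv t (interior_subset ht)).mono interior_subset) fun t ht ↦ ?_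
    have h1 := hle t (interior_subset ht)
    nlinarith [Real.exp_pos (-c * t)]
  have h2 : h 0 ≤ Real.exp (-c * T) * h T := by
    simpa using hmono (left_mem_Icc.2 hT) (right_mem_Icc.2 hT) hT
  calc Real.exp (c * T) * h 0 ≤ Real.exp (c * T) * (Real.exp (-c * T) * h T) := by gcongr
    _ = h T := by rw [← mul_assoc, ← Real.exp_add]; simp

/-- A set on whose differences a quadratic form is nonpositive is null when the form takes
a positive value. -/
lemma measure_eq_zero_of_form_sub_nonpos {F : Type*} [NormedAddCommGroup F]
    [InnerProductSpace ℝ F] [FiniteDimensional ℝ F] [MeasurableSpace F] [BorelSpace F]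
    (μ : Measure F) [μ.IsAddHaarMeasure] (X : F →L[ℝ] F) {v : F} (hv : 0 < ⟪v, X v⟫)
    {W : Set F} (hW : ∀ x ∈ W, ∀ y ∈ W, ⟪x - y, X (x - y)⟫ ≤ 0) : μ W = 0 := by
  have hcl : ∀ x ∈ closure W, ∀ y ∈ closure W, ⟪x - y, X (x - y)⟫ ≤ 0 := by
    intro x hx y hy
    have hclosed : IsClosed {p : F × F | ⟪p.1 - p.2, X (p.1 - p.2)⟫ ≤ 0} :=
      isClosed_le (by fun_prop) continuous_const
    have hsub : closure (W ×ˢ W) ⊆ {p : F × F | ⟪p.1 - p.2, X (p.1 - p.2)⟫ ≤ 0} :=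
      closure_minimal (fun p hp ↦ hW _ hp.1 _ hp.2) hclosed
    have hxy : (x, y) ∈ closure (W ×ˢ W) := by
      rw [closure_prod_eq]
      exact ⟨hx, hy⟩
    exact hsub hxy
  refine measure_mono_null subset_closure
    (Measure.addHaar_eq_zero_of_disjoint_translates μ (fun k : ℕ ↦ ((k : ℝ) + 1)⁻¹ • v) ?_ ?_
      isClosed_closure.measurableSet)
  · rw [isBounded_iff_forall_norm_le]
    refine ⟨‖v‖, ?_⟩
    rintro _ ⟨k, rfl⟩
    have h1 : ((k : ℝ) + 1)⁻¹ ≤ 1 := inv_le_one_of_one_le₀ (by linarith [k.cast_nonneg (α := ℝ)])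
    have h2 : (0 : ℝ) ≤ ((k : ℝ) + 1)⁻¹ := by positivity
    rw [norm_smul, Real.norm_of_nonneg h2]
    exact mul_le_of_le_one_left (norm_nonneg v) h1
  · intro k l hkl
    simp only [Function.onFun, image_add_left, singleton_add, disjoint_left, mem_preimage]
    intro y hk hl
    have h := hcl _ hk _ hl
    have heq : -(((k : ℝ) + 1)⁻¹ • v) + y - (-(((l : ℝ) + 1)⁻¹ • v) + y) =
        (((l : ℝ) + 1)⁻¹ - ((k : ℝ) + 1)⁻¹) • v := by
      rw [sub_smul]
      abel
    rw [heq, map_smul, real_inner_smul_left, inner_smul_right, ← mul_assoc] at h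
    have hne : ((l : ℝ) + 1)⁻¹ - ((k : ℝ) + 1)⁻¹ ≠ 0 := by
      rw [sub_ne_zero, Ne, inv_inj, add_left_inj, Nat.cast_inj]
      exact fun h ↦ hkl h.symm
    have := mul_pos (mul_self_pos.2 hne) hv
    linarith

/-- Lipschitz images of Haar-null sets are Haar-null. -/
lemma LipschitzOnWith.addHaar_image_eq_zero {F : Type*} [NormedAddCommGroup F] [NormedSpace ℝ F]
    [FiniteDimensional ℝ F] [MeasurableSpace F] [BorelSpace F] (μ : Measure F)
    [μ.IsAddHaarMeasure] {K : ℝ≥0} {g : F → F} {s : Set F} (hg : LipschitzOnWith K g s)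
    (hs : μ s = 0) : μ (g '' s) = 0 := by
  have h1 : Measure.hausdorffMeasure (Module.finrank ℝ F) s = 0 :=
    Measure.absolutelyContinuous_isAddHaarMeasure _ μ hs
  have h2 : Measure.hausdorffMeasure (Module.finrank ℝ F) (g '' s) = 0 := by
    refine le_antisymm ((hg.hausdorffMeasure_image_le (Nat.cast_nonneg _)).trans ?_) zero_le
    simp [h1]
  exact Measure.absolutelyContinuous_isAddHaarMeasure μ _ h2

/-- If a relation is backwards Lipschitz, preimages of Haar-null sets under it are Haar-null. -/
lemma addHaar_eq_zero_of_dist_le_mul {F : Type*} [NormedAddCommGroup F] [NormedSpace ℝ F]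
    [FiniteDimensional ℝ F] [MeasurableSpace F] [BorelSpace F] (μ : Measure F)
    [μ.IsAddHaarMeasure] {K : ℝ≥0} {R : F → F → Prop} {s W : Set F} (hW : μ W = 0)
    (hs : ∀ x ∈ s, ∃ w ∈ W, R x w)
    (hR : ∀ x w x' w', R x w → R x' w' → dist x x' ≤ K * dist w w') : μ s = 0 := by
  classical
  let V : Set F := {w ∈ W | ∃ x, R x w}
  let g : F → F := fun w ↦ if h : ∃ x, R x w then h.choose else 0
  have hg : ∀ w ∈ V, R (g w) w := by
    rintro w ⟨-, hw⟩
    simp only [g, dif_pos hw]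
    exact hw.choose_spec
  have hlip : LipschitzOnWith K g V :=
    LipschitzOnWith.of_dist_le_mul fun w hw w' hw' ↦ hR _ _ _ _ (hg w hw) (hg w' hw')
  refine measure_mono_null ?_
    (hlip.addHaar_image_eq_zero μ (measure_mono_null (sep_subset _ _) hW))
  intro x hx
  obtain ⟨w, hw, hxw⟩ := hs x hx
  refine ⟨w, ⟨hw, x, hxw⟩, ?_⟩
  have := hR _ _ _ _ (hg w ⟨hw, x, hxw⟩) hxw
  rw [dist_self, mul_zero] at this
  exact dist_le_zero.1 this

/-- Near an equilibrium with an unstable direction, the points whose forward solution never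
leaves a small neighbourhood form a null set. -/
lemma exists_nhds_measure_trapped_eq_zero {F : Type*} [NormedAddCommGroup F]
    [InnerProductSpace ℝ F] [FiniteDimensional ℝ F] [MeasurableSpace F] [BorelSpace F]
    (μ : Measure F) [μ.IsAddHaarMeasure] {f : F → F} {A : F →L[ℝ] F} {x₀ : F}
    (hf : HasStrictFDerivAt f A x₀) {α β : ℝ} (hα : 0 < α) {a b : F}
    (hab : a ≠ 0 ∨ b ≠ 0) (ha : A a = α • a - β • b) (hb : A b = β • a + α • b) :
    ∃ U ∈ nhds x₀, μ {ξ | ∃ φ : ℝ → F, φ 0 = ξ ∧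
      ∀ t ∈ Ici (0 : ℝ), φ t ∈ U ∧ HasDerivWithinAt φ (f (φ t)) (Ici 0) t} = 0 := by
  obtain ⟨c, X, v, hc, hX, hv⟩ := exists_shifted_lyapunov_form A hα hab ha hb
  let ε : ℝ≥0 := (2 * (‖X‖₊ + 1))⁻¹
  have hε : 0 < ε := by positivity
  have hεX : 2 * ‖X‖ * ε ≤ 1 := by
    have h0 := norm_nonneg X
    have : (ε : ℝ) = (2 * (‖X‖ + 1))⁻¹ := by simp [ε]
    rw [this, ← div_eq_mul_inv, div_le_one (by positivity)]
    linarith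
  obtain ⟨s, hs, happ⟩ := hf.approximates_deriv_on_nhds (Or.inr hε)
  refine ⟨s ∩ Metric.ball x₀ 1, inter_mem hs (Metric.ball_mem_nhds x₀ one_pos),
    measure_eq_zero_of_form_sub_nonpos μ X hv ?_⟩
  rintro _ ⟨φ, rfl, hφ⟩ _ ⟨ψ, rfl, hψ⟩
  by_contra! hpos
  have hgrow : ∀ T, 0 ≤ T →
      Real.exp (c * T) * ⟪φ 0 - ψ 0, X (φ 0 - ψ 0)⟫ ≤ ⟪φ T - ψ T, X (φ T - ψ T)⟫ := by
    intro T hT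
    refine exp_mul_le_of_mul_le_deriv (h := fun t ↦ ⟪φ t - ψ t, X (φ t - ψ t)⟫)
      (h' := fun t ↦ ⟪φ t - ψ t, X (f (φ t) - f (ψ t))⟫ + ⟪f (φ t) - f (ψ t), X (φ t - ψ t)⟫) hT
      (fun t ht ↦ ?_) fun t ht ↦ ?_
    · have hd : HasDerivWithinAt (fun t ↦ φ t - ψ t) (f (φ t) - f (ψ t)) (Icc 0 T) t :=
        ((hφ t ht.1).2.sub (hψ t ht.1).2).mono Icc_subset_Ici_self
      exact hd.inner ℝ (X.hasFDerivAt.comp_hasDerivWithinAt t hd)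
    · set z := φ t - ψ t
      set g := f (φ t) - f (ψ t) - A z
      have hg : ‖g‖ ≤ ε * ‖z‖ := happ _ (hφ t ht.1).1.1 _ (hψ t ht.1).1.1
      have hfz : f (φ t) - f (ψ t) = A z + g := by simp [g]
      have hXz := X.le_opNorm z
      have hXg := X.le_opNorm g
      have h1 : -(‖z‖ * (‖X‖ * (ε * ‖z‖))) ≤ ⟪z, X g⟫ := by
        refine le_trans (neg_le_neg ?_) (neg_le_of_abs_le (abs_real_inner_le_norm z (X g)))
        gcongr
        exact hXg.trans (by gcongr)
      have h2 : -(ε * ‖z‖ * (‖X‖ * ‖z‖)) ≤ ⟪g, X z⟫ := by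
        refine le_trans (neg_le_neg ?_) (neg_le_of_abs_le (abs_real_inner_le_norm g (X z)))
        gcongr
      have h3 := hX z
      have h4 := mul_le_mul_of_nonneg_right hεX (sq_nonneg ‖z‖)
      rw [hfz, map_add, inner_add_right, inner_add_left]
      linarith
  have hbdd : ∀ T, 0 ≤ T → ⟪φ T - ψ T, X (φ T - ψ T)⟫ ≤ 2 * (‖X‖ * 2) := by
    intro T hT
    have hz : ‖φ T - ψ T‖ ≤ 2 := by
      have h1 := Metric.mem_ball.1 (hφ T hT).1.2
      have h2 := Metric.mem_ball.1 (hψ T hT).1.2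
      have h3 := dist_triangle_right (φ T) (ψ T) x₀
      rw [dist_eq_norm (φ T) (ψ T)] at h3
      linarith
    refine (real_inner_le_norm _ _).trans ?_
    have := X.le_opNorm (φ T - ψ T)
    gcongr
    exact this.trans (by gcongr)
  have htend : Tendsto (fun T ↦ Real.exp (c * T) * ⟪φ 0 - ψ 0, X (φ 0 - ψ 0)⟫) atTop atTop :=
    (Real.tendsto_exp_atTop.comp (tendsto_id.const_mul_atTop hc)).atTop_mul_const hpos
  obtain ⟨T, hT, hlt⟩ :=
    ((eventually_ge_atTop 0).and (htend.eventually_gt_atTop (2 * (‖X‖ * 2)))).exists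
  exact absurd (hlt.trans_le ((hgrow T hT).trans (hbdd T hT))) (lt_irrefl _)

/-- Two solutions of a Lipschitz equation separate backwards in time at most exponentially. -/
lemma dist_zero_le_exp_mul_dist {F : Type*} [NormedAddCommGroup F] [InnerProductSpace ℝ F]
    {f : F → F} {L : ℝ≥0} {K : Set F} (hf : LipschitzOnWith L f K) {T : ℝ} (hT : 0 ≤ T)
    {φ ψ : ℝ → F} (hφ : ∀ t ∈ Icc 0 T, φ t ∈ K ∧ HasDerivWithinAt φ (f (φ t)) (Icc 0 T) t)
    (hψ : ∀ t ∈ Icc 0 T, ψ t ∈ K ∧ HasDerivWithinAt ψ (f (ψ t)) (Icc 0 T) t) :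
    dist (φ 0) (ψ 0) ≤ Real.exp (L * T) * dist (φ T) (ψ T) := by
  have hsq : Real.exp (-(2 * L) * T) * ⟪φ 0 - ψ 0, φ 0 - ψ 0⟫ ≤ ⟪φ T - ψ T, φ T - ψ T⟫ := by
    refine exp_mul_le_of_mul_le_deriv (h := fun t ↦ ⟪φ t - ψ t, φ t - ψ t⟫)
      (h' := fun t ↦ ⟪φ t - ψ t, f (φ t) - f (ψ t)⟫ + ⟪f (φ t) - f (ψ t), φ t - ψ t⟫) hT
      (fun t ht ↦ ?_) fun t ht ↦ ?_
    · have hd := (hφ t ht).2.sub (hψ t ht).2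
      exact hd.inner ℝ hd
    · have h1 : ‖f (φ t) - f (ψ t)‖ ≤ L * ‖φ t - ψ t‖ := by
        simpa [dist_eq_norm] using hf.dist_le_mul _ (hφ t ht).1 _ (hψ t ht).1
      have h2 := neg_le_of_abs_le (abs_real_inner_le_norm (φ t - ψ t) (f (φ t) - f (ψ t)))
      have h3 := mul_le_mul_of_nonneg_left h1 (norm_nonneg (φ t - ψ t))
      rw [real_inner_comm (φ t - ψ t) (f (φ t) - f (ψ t)), real_inner_self_eq_norm_sq]
      nlinarith
  simp only [real_inner_self_eq_norm_sq, ← dist_eq_norm] at hsq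
  refine le_of_sq_le_sq ?_ (by positivity)
  calc dist (φ 0) (ψ 0) ^ 2
      = Real.exp (2 * L * T) * (Real.exp (-(2 * L) * T) * dist (φ 0) (ψ 0) ^ 2) := by
        rw [← mul_assoc, ← Real.exp_add]
        simp
    _ ≤ Real.exp (2 * L * T) * dist (φ T) (ψ T) ^ 2 := by gcongr
    _ = (Real.exp (L * T) * dist (φ T) (ψ T)) ^ 2 := by
        rw [mul_pow, ← Real.exp_nat_mul]
        push_cast
        ring_nf

/-- A root of the complexified characteristic polynomial gives an invariant real pair. -/
lemma exists_toEuclideanCLM_eq_of_isRoot_charpoly {n : ℕ} (J : Matrix (Fin n) (Fin n) ℝ) {μ : ℂ}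
    (hμ : (J.map (fun x : ℝ => (x : ℂ))).charpoly.IsRoot μ) :
    ∃ a b : EuclideanSpace ℝ (Fin n), (a ≠ 0 ∨ b ≠ 0) ∧
      Matrix.toEuclideanCLM (𝕜 := ℝ) J a = μ.re • a - μ.im • b ∧
      Matrix.toEuclideanCLM (𝕜 := ℝ) J b = μ.im • a + μ.re • b := by
  rw [← Matrix.mem_spectrum_iff_isRoot_charpoly, ← Matrix.spectrum_toLin',
    ← Module.End.hasEigenvalue_iff_mem_spectrum] at hμ
  obtain ⟨w, hw⟩ := hμ.exists_hasEigenvector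
  have hJw : ∀ i, ∑ j, (J i j : ℂ) * w j = μ * w i := by
    intro i
    have := congrFun hw.apply_eq_smul i
    simpa [Matrix.mulVec, dotProduct] using this
  refine ⟨WithLp.toLp 2 fun i ↦ (w i).re, WithLp.toLp 2 fun i ↦ (w i).im, ?_, ?_, ?_⟩
  · by_contra! h
    refine hw.2 (funext fun i ↦ Complex.ext ?_ ?_)
    · simpa using congrArg (fun y : EuclideanSpace ℝ (Fin n) ↦ y i) h.1
    · simpa using congrArg (fun y : EuclideanSpace ℝ (Fin n) ↦ y i) h.2
  · ext i
    have := congrArg Complex.re (hJw i)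
    simpa [Matrix.mulVec, dotProduct, Matrix.toEuclideanCLM_toLp] using this
  · ext i
    have := congrArg Complex.im (hJw i)
    simpa [Matrix.mulVec, dotProduct, Matrix.toEuclideanCLM_toLp, add_comm] using this

/-- **Convergence to a set of strict saddles happens on a measure-zero set.**
Let `f` be `C¹` on an open set `𝕏 ⊆ ℝⁿ` and let `E ⊆ 𝕏` consist of strict saddle
equilibria of `ẋ = f(x)` (each `x̄ ∈ E` satisfies `f(x̄) = 0` and the Jacobian of `f` at `x̄`
has a complex eigenvalue with strictly positive real part and one with nonpositive real part).
Then the set of initial points whose forward solution exists for all `t ≥ 0` and converges to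
a point of `E` has Lebesgue measure zero. -/
theorem strict_saddle_convergence_measure_zero {n : ℕ}
    (𝕏 : Set (EuclideanSpace ℝ (Fin n))) (hX : IsOpen 𝕏)
    (f : EuclideanSpace ℝ (Fin n) → EuclideanSpace ℝ (Fin n))
    (hf : ContDiffOn ℝ 1 f 𝕏)
    (E : Set (EuclideanSpace ℝ (Fin n))) (hE : E ⊆ 𝕏)
    (hsaddle : ∀ xbar ∈ E, f xbar = 0 ∧
      ∃ J : Matrix (Fin n) (Fin n) ℝ,
        HasFDerivAt f (Matrix.toEuclideanCLM (𝕜 := ℝ) J) xbar ∧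
        (∃ μ : ℂ, (J.map (fun x : ℝ => (x : ℂ))).charpoly.IsRoot μ ∧ 0 < μ.re) ∧
        (∃ μ : ℂ, (J.map (fun x : ℝ => (x : ℂ))).charpoly.IsRoot μ ∧ μ.re ≤ 0)) :
    volume {ξ : EuclideanSpace ℝ (Fin n) | ξ ∈ 𝕏 ∧
      ∃ φ : ℝ → EuclideanSpace ℝ (Fin n), φ 0 = ξ ∧
        (∀ t ∈ Ici (0 : ℝ), φ t ∈ 𝕏 ∧ HasDerivWithinAt φ (f (φ t)) (Ici 0) t) ∧
        ∃ x ∈ E, Tendsto φ atTop (nhds x)} = 0 := by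
  have hstrict : ∀ x ∈ E, ∃ U ∈ nhds x, volume {ξ | ∃ φ : ℝ → EuclideanSpace ℝ (Fin n), φ 0 = ξ ∧
      ∀ t ∈ Ici (0 : ℝ), φ t ∈ U ∧ HasDerivWithinAt φ (f (φ t)) (Ici 0) t} = 0 := by
    intro x hx
    obtain ⟨-, J, hJ, ⟨μ, hμ, hμre⟩, -⟩ := hsaddle x hx
    obtain ⟨a, b, hab, ha, hb⟩ := exists_toEuclideanCLM_eq_of_isRoot_charpoly J hμ
    exact exists_nhds_measure_trapped_eq_zero volume
      ((hf.contDiffAt (hX.mem_nhds (hE hx))).hasStrictFDerivAt' hJ one_ne_zero) hμre hab ha hb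
  choose! U hU hUnull using hstrict
  obtain ⟨s, hsE, hs, hcover⟩ :=
    TopologicalSpace.countable_cover_nhdsWithin fun x hx ↦
      mem_nhdsWithin_of_mem_nhds (interior_mem_nhds.2 (hU x hx))
  have : LocallyCompactSpace 𝕏 := hX.locallyCompactSpace
  let κ : CompactExhaustion 𝕏 := default
  let K : ℕ → Set (EuclideanSpace ℝ (Fin n)) := fun m ↦ Subtype.val '' κ m
  have hK : ∀ m, ∃ L, LipschitzOnWith L f (K m) := fun m ↦ by
    refine LocallyLipschitzOn.exists_lipschitzOnWith_of_compact
      ((κ.isCompact m).image continuous_subtype_val) ?_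
    rintro _ ⟨x, -, rfl⟩
    obtain ⟨L, t, ht, hL⟩ :=
      (hf.contDiffAt (hX.mem_nhds x.2)).exists_lipschitzOnWith
    exact ⟨L, t, mem_nhdsWithin_of_mem_nhds ht, hL⟩
  let R (m k : ℕ) (ξ w : EuclideanSpace ℝ (Fin n)) : Prop :=
    ∃ φ : ℝ → EuclideanSpace ℝ (Fin n), φ 0 = ξ ∧ φ k = w ∧
      ∀ t ∈ Icc (0 : ℝ) k, φ t ∈ K m ∧ HasDerivWithinAt φ (f (φ t)) (Icc 0 (k : ℝ)) t
  let W (x : EuclideanSpace ℝ (Fin n)) : Set (EuclideanSpace ℝ (Fin n)) :=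
    {ξ | ∃ φ : ℝ → EuclideanSpace ℝ (Fin n), φ 0 = ξ ∧
      ∀ t ∈ Ici (0 : ℝ), φ t ∈ U x ∧ HasDerivWithinAt φ (f (φ t)) (Ici 0) t}
  have hnull : ∀ x ∈ s, ∀ m k, volume {ξ | ∃ w ∈ W x, R m k ξ w} = 0 := by
    intro x hx m k
    obtain ⟨L, hL⟩ := hK m
    refine addHaar_eq_zero_of_dist_le_mul (K := ⟨Real.exp (L * k), (Real.exp_pos _).le⟩) (R := R m k)
      volume (hUnull x (hsE hx)) (fun ξ hξ ↦ hξ) ?_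
    rintro _ _ _ _ ⟨φ, rfl, rfl, hφ⟩ ⟨ψ, rfl, rfl, hψ⟩
    exact dist_zero_le_exp_mul_dist hL k.cast_nonneg hφ hψ
  refine measure_mono_null (t := ⋃ x ∈ s, ⋃ m, ⋃ k, {ξ | ∃ w ∈ W x, R m k ξ w}) ?_ ?_
  · rintro ξ ⟨-, φ, hφ0, hφ, y, hy, hlim⟩
    obtain ⟨x, hx, hyx⟩ := mem_iUnion₂.1 (hcover hy)
    obtain ⟨T, hT⟩ := eventually_atTop.1 (hlim.eventually (mem_interior_iff_mem_nhds.1 hyx))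
    obtain ⟨k, hk⟩ := exists_nat_ge T
    have hcont : ContinuousOn φ (Icc 0 (k : ℝ)) :=
      fun t ht ↦ (hφ t ht.1).2.continuousWithinAt.mono Icc_subset_Ici_self
    obtain ⟨m, hm⟩ := κ.exists_superset_of_isCompact
      (Topology.IsInducing.subtypeVal.isCompact_preimage_iff (fun z hz ↦ by
        obtain ⟨t, ht, rfl⟩ := hz
        simpa using (hφ t ht.1).1) |>.2 (isCompact_Icc.image_of_continuousOn hcont))
    simp only [mem_iUnion]
    refine ⟨x, hx, m, k, φ k, ⟨fun t ↦ φ (k + t), by simp, fun t ht ↦ ⟨?_, ?_⟩⟩,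
      φ, hφ0, rfl, fun t ht ↦ ⟨?_, (hφ t ht.1).2.mono Icc_subset_Ici_self⟩⟩
    · exact hT _ (by linarith [mem_Ici.1 ht])
    · have hk0 : (0 : ℝ) ≤ k := k.cast_nonneg
      have hshift : HasDerivWithinAt (fun t : ℝ ↦ (k : ℝ) + t) 1 (Ici 0) t :=
        ((hasDerivAt_id t).const_add (k : ℝ)).hasDerivWithinAt
      have hcomp := (hφ (k + t) (add_nonneg hk0 ht)).2.scomp t hshift fun u hu ↦ add_nonneg hk0 hu
      rw [one_smul] at hcomp
      exact hcomp
    · exact ⟨⟨φ t, (hφ t ht.1).1⟩, hm (mem_image_of_mem φ ht), rfl⟩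
  · refine (measure_biUnion_null_iff hs).2 fun x hx ↦ ?_
    exact measure_iUnion_null fun m ↦ measure_iUnion_null fun k ↦ hnull x hx m k
end
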